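/- Let G be the simple graph on vertices x_1, ..., x_7 with edge set {x_1x_2, x_2x_3, x_3x_4, x_3x_6, x_6x_7, x_7x_4, x_4x_5, x_5x_1, x_1x_7, x_5x_6}. Then G has maximum degree 3 and G admits no (1,2^6)-packing edge-coloring. -/

import Mathlib

open SimpleGraph

/-- A `(1,2^k)`-packing edge-coloring encoded as a function assigning a color in
`Fin (k+1)` to each unordered pair. Color `0` is the 1-color (its class must be a
matching) and each color `i ≠ 0` is a 2-color (its class must be an induced matching). -/
def IsPackingEC {V : Type} (G : SimpleGraph V) (k : ℕ)
    (c : Sym2 V → Fin (k + 1)) : Prop :=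
  (∀ a b x y : V, G.Adj a b → G.Adj x y → s(a, b) ≠ s(x, y) →
      c s(a, b) = 0 → c s(x, y) = 0 →
      a ≠ x ∧ a ≠ y ∧ b ≠ x ∧ b ≠ y) ∧
  ∀ a b x y : V, G.Adj a b → G.Adj x y → s(a, b) ≠ s(x, y) →
      c s(a, b) = c s(x, y) → c s(a, b) ≠ 0 →
      (a ≠ x ∧ a ≠ y ∧ b ≠ x ∧ b ≠ y) ∧
      ¬G.Adj a x ∧ ¬G.Adj a y ∧ ¬G.Adj b x ∧ ¬G.Adj b y

/-- A good coloring: a `(1,2^7)`-packing edge-coloring in which every edge of the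
1-color class (color `0`) has both endpoints of degree 3. -/
def GoodColoring {V : Type} (G : SimpleGraph V) (c : Sym2 V → Fin 8) : Prop :=
  IsPackingEC G 7 c ∧
  ∀ a b : V, G.Adj a b → c s(a, b) = 0 →
    (G.neighborSet a).ncard = 3 ∧ (G.neighborSet b).ncard = 3

/-- A graph is subcubic if every vertex has degree at most 3. -/
def Subcubic {V : Type} (G : SimpleGraph V) : Prop :=
  ∀ v : V, (G.neighborSet v).ncard ≤ 3

/-- A minimal counterexample: a finite subcubic simple graph with no good coloring such
that every finite subcubic simple graph with smaller `|V| + |E|` has a good coloring. -/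
def MinCounter (V : Type) [Finite V] (G : SimpleGraph V) : Prop :=
  Subcubic G ∧
  (¬∃ c : Sym2 V → Fin 8, GoodColoring G c) ∧
  ∀ (W : Type) [Finite W] (H : SimpleGraph W), Subcubic H →
    Nat.card W + H.edgeSet.ncard < Nat.card V + G.edgeSet.ncard →
    ∃ c : Sym2 W → Fin 8, GoodColoring H c

/-- The sharpness example: the graph on vertices `x_1, …, x_7` (here `0, …, 6`) with the
ten edges `x_1x_2, x_2x_3, x_3x_4, x_3x_6, x_6x_7, x_7x_4, x_4x_5, x_5x_1, x_1x_7, x_5x_6`. -/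
def sharpExample : SimpleGraph (Fin 7) :=
  SimpleGraph.fromRel (fun a b =>
    ((a, b) : Fin 7 × Fin 7) ∈
      [((0 : Fin 7), (1 : Fin 7)), (1, 2), (2, 3), (2, 5), (5, 6), (6, 3), (3, 4),
        (4, 0), (0, 6), (4, 5)])

instance : DecidableRel sharpExample.Adj := by
  unfold sharpExample
  infer_instance

/-- The edges of `sharpExample`, each listed with one orientation. -/
def sharpEdges : Finset (Fin 7 × Fin 7) :=
  {(0, 1), (1, 2), (2, 3), (2, 5), (5, 6), (6, 3), (3, 4), (4, 0), (0, 6), (4, 5)}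

theorem sharpExample_adj_of_mem_sharpEdges :
    ∀ p ∈ sharpEdges, sharpExample.Adj p.1 p.2 := by
  decide

theorem sym2_mk_ne_of_mem_sharpEdges :
    ∀ p ∈ sharpEdges, ∀ q ∈ sharpEdges, p ≠ q → s(p.1, p.2) ≠ s(q.1, q.2) := by
  decide

/-- No two distinct edges of `sharpExample` form an induced matching. -/
theorem sharpEdges_not_induced_matching :
    ∀ p ∈ sharpEdges, ∀ q ∈ sharpEdges, p ≠ q →
      ¬((p.1 ≠ q.1 ∧ p.1 ≠ q.2 ∧ p.2 ≠ q.1 ∧ p.2 ≠ q.2) ∧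
        ¬sharpExample.Adj p.1 q.1 ∧ ¬sharpExample.Adj p.1 q.2 ∧
        ¬sharpExample.Adj p.2 q.1 ∧ ¬sharpExample.Adj p.2 q.2) := by
  decide

theorem sharpExample_ncard_neighborSet (v : Fin 7) :
    (sharpExample.neighborSet v).ncard = sharpExample.degree v := by
  rw [← SimpleGraph.card_neighborSet_eq_degree, ← Nat.card_eq_fintype_card, Nat.card_coe_set_eq]

/-- A set of pairwise vertex-disjoint edges on seven vertices has at most three elements. -/
theorem card_le_three_of_pairwise_disjoint (S : Finset (Fin 7 × Fin 7))
    (hne : ∀ p ∈ S, p.1 ≠ p.2)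
    (hS : ∀ p ∈ S, ∀ q ∈ S, p ≠ q → p.1 ≠ q.1 ∧ p.1 ≠ q.2 ∧ p.2 ≠ q.1 ∧ p.2 ≠ q.2) :
    S.card ≤ 3 := by
  have hcard : (S.biUnion fun p => {p.1, p.2}).card = S.card * 2 := by
    rw [Finset.card_biUnion, Finset.sum_const_nat]
    · exact fun p hp => Finset.card_pair (hne p hp)
    · intro p hp q hq hpq
      obtain ⟨h₁, h₂, h₃, h₄⟩ := hS p hp q hq hpq
      simp [h₁.symm, h₂.symm, h₃.symm, h₄.symm]
  have hle := Finset.card_le_univ (S.biUnion fun p => {p.1, p.2})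
  rw [hcard, Fintype.card_fin] at hle
  omega

/-- The sharpness example has maximum degree 3 and admits no `(1,2^6)`-packing
edge-coloring. -/
theorem sharpExample_no_126_coloring :
    (∀ v, (sharpExample.neighborSet v).ncard ≤ 3) ∧
    (∃ v, (sharpExample.neighborSet v).ncard = 3) ∧
    ¬∃ c : Sym2 (Fin 7) → Fin 7, IsPackingEC sharpExample 6 c := by
  simp only [sharpExample_ncard_neighborSet]
  refine ⟨by decide, ⟨0, by decide⟩, ?_⟩
  rintro ⟨c, hmatch, hind⟩
  have hadj := sharpExample_adj_of_mem_sharpEdges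
  have hzero : (sharpEdges.filter fun p => c s(p.1, p.2) = 0).card ≤ 3 := by
    apply card_le_three_of_pairwise_disjoint
    · intro p hp
      exact (hadj p (Finset.mem_filter.1 hp).1).ne
    · intro p hp q hq hpq
      obtain ⟨hp, hcp⟩ := Finset.mem_filter.1 hp
      obtain ⟨hq, hcq⟩ := Finset.mem_filter.1 hq
      exact hmatch _ _ _ _ (hadj p hp) (hadj q hq)
        (sym2_mk_ne_of_mem_sharpEdges p hp q hq hpq) hcp hcq
  have hpos : (sharpEdges.filter fun p => ¬c s(p.1, p.2) = 0).card ≤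
      ((Finset.univ : Finset (Fin 7)).erase 0).card := by
    apply Finset.card_le_card_of_injOn (fun p => c s(p.1, p.2))
    · intro p hp
      simpa using (Finset.mem_filter.1 hp).2
    · intro p hp q hq hpq
      obtain ⟨hp, hcp⟩ := Finset.mem_filter.1 hp
      obtain ⟨hq, -⟩ := Finset.mem_filter.1 hq
      by_contra hne
      exact sharpEdges_not_induced_matching p hp q hq hne
        (hind _ _ _ _ (hadj p hp) (hadj q hq)
          (sym2_mk_ne_of_mem_sharpEdges p hp q hq hne) hpq hcp)
  have herase : ((Finset.univ : Finset (Fin 7)).erase 0).card = 6 := by decide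
  have hsum := Finset.card_filter_add_card_filter_not
    (s := sharpEdges) (fun p => c s(p.1, p.2) = 0)
  have hedges : sharpEdges.card = 10 := by decide
  omega
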